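/- Fix K ∈ ℕ and extend γ to all of sl(m+1,ℝ) by γ(M) := γ(ξ), where ξ is the g₁-component of M. Define 𝓛_M := L_{X^M} + γ(M) on C^∞(ℝ^m, ⊕_{k=0}^K S^k ℝ^m ⊗ Hom(V₁,V₂)), where γ(M) acts pointwise. Then M ↦ 𝓛_M is a representation of sl(m+1,ℝ): [𝓛_M, 𝓛_N] = 𝓛_{[M,N]} for all M, N ∈ sl(m+1,ℝ). (Equivalently, γ is a Chevalley–Eilenberg 1-cocycle of sl(m+1,ℝ) with values in the operators on symbols.) -/

import Mathlib

open scoped BigOperators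
noncomputable section
namespace ProjQuant

/-- `ℝ^m`. -/
abbrev Rm (m : ℕ) := Fin m → ℝ

/-- The index set for `(m+1) × (m+1)` matrices, split into blocks. -/
abbrev Idx (m : ℕ) := Sum (Fin m) Unit

/-- `gl(m,ℝ)`, realized as continuous linear endomorphisms of `ℝ^m`. -/
abbrev GLm (m : ℕ) := (Fin m → ℝ) →L[ℝ] (Fin m → ℝ)

/-- `ℝ^{m*}`. -/
abbrev Dualm (m : ℕ) := (Fin m → ℝ) →L[ℝ] ℝ

/-- The vector field `X^M` on `ℝ^m` attached to a matrix
`M = [[A, v], [ξ, a]] ∈ sl(m+1,ℝ)`, namely `X^M(x) = -v - A x + a x + ξ(x) x`. -/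
def projVF (m : ℕ) (M : Matrix (Idx m) (Idx m) ℝ) : Rm m → Rm m := fun x i =>
  -(M (Sum.inl i) (Sum.inr ())) - (∑ j, M (Sum.inl i) (Sum.inl j) * x j)
    + M (Sum.inr ()) (Sum.inr ()) * x i
    + (∑ j, M (Sum.inr ()) (Sum.inl j) * x j) * x i

/-- The Lie derivative of a `V`-valued function along a vector field `X`, with respect to a
representation `σ` of `gl(m,ℝ)` on `V`:  `(L_X f)(x) = Df(x)[X(x)] - σ(DX(x))(f(x))`. -/
def lieD (m : ℕ) {V : Type} [NormedAddCommGroup V] [NormedSpace ℝ V]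
    (σ : GLm m → V → V) (X : Rm m → Rm m) (f : Rm m → V) : Rm m → V :=
  fun x => fderiv ℝ f x (X x) - σ (fderiv ℝ X x) (f x)

/-- `σ` is a Lie algebra representation of `gl(m,ℝ)`. -/
def IsLieRep (m : ℕ) {V : Type} [NormedAddCommGroup V] [NormedSpace ℝ V]
    (σ : GLm m →ₗ[ℝ] (V →L[ℝ] V)) : Prop :=
  ∀ A B : GLm m, σ (A ∘L B - B ∘L A) = σ A ∘L σ B - σ B ∘L σ A


/-- Iterated Lie derivative along the constant fields `X^{hᵢ} = -hᵢ`, outermost first. -/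
def lieItC (m : ℕ) {V : Type} [NormedAddCommGroup V] [NormedSpace ℝ V]
    (σ : GLm m → V → V) : (k : ℕ) → (Fin k → Rm m) → (Rm m → V) → (Rm m → V)
  | 0, _, f => f
  | (k+1), v, f => lieD m σ (fun _ => -(v 0)) (lieItC m σ k (fun j => v j.succ) f)

section Symbols

variable (m : ℕ) (V₁ V₂ : Type)
  [NormedAddCommGroup V₁] [NormedSpace ℝ V₁] [NormedAddCommGroup V₂] [NormedSpace ℝ V₂]

/-- The model for `S^k ℝ^m ⊗ Hom(V₁,V₂)`: multilinear maps on `k` copies of `ℝ^{m*}`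
with values in `Hom(V₁,V₂)` (symbols of degree `k` are the symmetric ones). -/
abbrev Symb (k : ℕ) := ContinuousMultilinearMap ℝ (fun _ : Fin k => Dualm m) (V₁ →L[ℝ] V₂)

/-- The decomposable tensor `h₁ ⊗ ⋯ ⊗ h_k ⊗ A` in the model. -/
def pureT {k : ℕ} (v : Fin k → Rm m) (A : V₁ →L[ℝ] V₂) : Symb m V₁ V₂ k :=
  (ContinuousMultilinearMap.mkPiRing ℝ (Fin k) A).compContinuousLinearMap
    (fun i => ContinuousLinearMap.apply ℝ ℝ (v i))

/-- The symmetric product `h₁ ∨ ⋯ ∨ h_k ⊗ A` in the model. -/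
def symT {k : ℕ} (v : Fin k → Rm m) (A : V₁ →L[ℝ] V₂) : Symb m V₁ V₂ k :=
  ∑ ν : Equiv.Perm (Fin k), pureT m V₁ V₂ (v ∘ ν) A

/-- The subspace of the model corresponding to `S^k ℝ^m ⊗ Hom(V₁,V₂)` itself:
the span of the symmetric products. -/
def spanGen (k : ℕ) : Submodule ℝ (Symb m V₁ V₂ k) :=
  Submodule.span ℝ {T | ∃ (v : Fin k → Rm m) (A : V₁ →L[ℝ] V₂), T = symT m V₁ V₂ v A}

/-- The rank-one endomorphism `u ⊗ h : x ↦ h(x) • u` of `ℝ^m`. -/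
def rkOne (u : Rm m) (h : Dualm m) : GLm m := h.smulRight u

variable (σ₁ : GLm m →ₗ[ℝ] (V₁ →L[ℝ] V₁)) (σ₂ : GLm m →ₗ[ℝ] (V₂ →L[ℝ] V₂))

/-- The representation `σ^{(k)}` of `gl(m,ℝ)` on `S^k ℝ^m ⊗ Hom(V₁,V₂)`, determined by
`σ^{(k)}(B)(h₁∨⋯∨h_k ⊗ A) = Σᵢ h₁∨⋯∨(B hᵢ)∨⋯∨h_k ⊗ A + h₁∨⋯∨h_k ⊗ (σ₂(B)∘A - A∘σ₁(B))`. -/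
def sigmaS {k : ℕ} (B : GLm m) (T : Symb m V₁ V₂ k) : Symb m V₁ V₂ k :=
  (∑ t : Fin k, T.compContinuousLinearMap
    (fun s => if s = t then (ContinuousLinearMap.compL ℝ (Rm m) (Rm m) ℝ).flip B
      else ContinuousLinearMap.id ℝ (Dualm m)))
  + ((ContinuousLinearMap.compL ℝ V₁ V₂ V₂ (σ₂ B))
      - (ContinuousLinearMap.compL ℝ V₁ V₁ V₂).flip (σ₁ B)).compContinuousMultilinearMap T

/-- The `i`-th coordinate covector on `ℝ^m`. -/
def coordD (i : Fin m) : Dualm m := ContinuousLinearMap.proj i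

/-- The affine quantization (standard ordering): the full contraction of a degree-`k` symbol
with the `k`-th derivative, `Q_Aff(h₁∨⋯∨h_k ⊗ A)(f) = A(∂_{h₁} ⋯ ∂_{h_k} f)`. -/
def QAff {k : ℕ} (T : Rm m → Symb m V₁ V₂ k) (f : Rm m → V₁) : Rm m → V₂ :=
  fun x => (k.factorial : ℝ)⁻¹ • ∑ d : Fin k → Fin m,
    (T x (fun t => coordD m (d t))) (iteratedFDeriv ℝ k f x (fun t => Pi.single (d t) 1))

/-- The defining property of the map `γ(h) : S^{k+1} ℝ^m ⊗ Hom(V₁,V₂) → S^k ℝ^m ⊗ Hom(V₁,V₂)`,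
for `h ∈ ℝ^{m*} ≅ 𝔤₁`:
`γ(h)(h₁∨⋯∨h_{k+1} ⊗ A) = Σᵢ h₁∨⋯(omit hᵢ)⋯∨h_{k+1} ⊗ (A ∘ σ₁(hᵢ⊗h + h(hᵢ)·Id))`
`- Σᵢ Σ_{j<i} h₁∨⋯(omit hⱼ,hᵢ)⋯∨h_{k+1} ∨ (h(hⱼ)·hᵢ + h(hᵢ)·hⱼ) ⊗ A`. -/
def gammaProp {k : ℕ}
    (γ : Dualm m → (Symb m V₁ V₂ (k+1) →ₗ[ℝ] Symb m V₁ V₂ k)) : Prop :=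
  ∀ (h : Dualm m) (v : Fin (k+1) → Rm m) (A : V₁ →L[ℝ] V₂),
    γ h (symT m V₁ V₂ v A) =
      (∑ i : Fin (k+1), symT m V₁ V₂ (i.removeNth v)
        (A.comp (σ₁ (rkOne m (v i) h + h (v i) • ContinuousLinearMap.id ℝ (Rm m)))))
      - ∑ i : Fin (k+1), ∑ j : Fin k,
          if (i.succAbove j : ℕ) < (i : ℕ) then
            symT m V₁ V₂ (i.removeNth (Function.update v (i.succAbove j)
              (h (v (i.succAbove j)) • v i + h (v i) • v (i.succAbove j)))) A
          else 0

/-- The model for `⊕_{k=0}^K S^k ℝ^m ⊗ Hom(V₁,V₂)`. -/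
abbrev SymbT (K : ℕ) := ∀ k : Fin (K+1), Symb m V₁ V₂ (k : ℕ)

/-- The degree-wise representation `⊕_k σ^{(k)}` on `⊕_{k=0}^K S^k ℝ^m ⊗ Hom(V₁,V₂)`. -/
def sigmaT {K : ℕ} (B : GLm m) (T : SymbT m V₁ V₂ K) : SymbT m V₁ V₂ K :=
  fun k => sigmaS m V₁ V₂ σ₁ σ₂ B (T k)

/-- The extension of a family `γ` to `⊕_{k=0}^K S^k ℝ^m ⊗ Hom(V₁,V₂)` (lowering degree). -/
def gTot {K : ℕ} (γf : ∀ k : ℕ, Dualm m → (Symb m V₁ V₂ (k+1) →ₗ[ℝ] Symb m V₁ V₂ k))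
    (h : Dualm m) (T : SymbT m V₁ V₂ K) : SymbT m V₁ V₂ K :=
  fun k => if hk : (k : ℕ) + 1 < K + 1 then γf (k : ℕ) h (T ⟨(k : ℕ) + 1, hk⟩) else 0


/-- The action `ρ^{(k)}(a) = S^k a ⊗ (Φ ↦ ρ₂(a)∘Φ∘ρ₁(a)⁻¹)` of `GL(m,ℝ)` on
`S^k ℝ^m ⊗ Hom(V₁,V₂)`, in the model. -/
def rhoK {k : ℕ} (a : (Fin m → ℝ) ≃L[ℝ] (Fin m → ℝ)) (r₁ : V₁ ≃L[ℝ] V₁) (r₂ : V₂ ≃L[ℝ] V₂)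
    (T : Symb m V₁ V₂ k) : Symb m V₁ V₂ k :=
  ((ContinuousLinearMap.compL ℝ V₁ V₂ V₂ (r₂ : V₂ →L[ℝ] V₂)) ∘L
    ((ContinuousLinearMap.compL ℝ V₁ V₁ V₂).flip
      ((r₁.symm : V₁ →L[ℝ] V₁)))).compContinuousMultilinearMap
    (T.compContinuousLinearMap
      (fun _ => (ContinuousLinearMap.compL ℝ (Rm m) (Rm m) ℝ).flip
        (a : (Fin m → ℝ) →L[ℝ] (Fin m → ℝ))))

end Symbols

section Matrices

variable (m : ℕ)

/-- The element of `𝔤₁ ⊂ sl(m+1,ℝ)` with `ξ`-block the covector `h`. -/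
def hMat (h : Dualm m) : Matrix (Idx m) (Idx m) ℝ :=
  Matrix.fromBlocks 0 0 (Matrix.of fun _ j => h (Pi.single j 1)) 0

/-- The element of `𝔤₋₁ ⊂ sl(m+1,ℝ)` with `v`-block the vector `X`. -/
def XMat (X : Rm m) : Matrix (Idx m) (Idx m) ℝ :=
  Matrix.fromBlocks 0 (Matrix.of fun i _ => X i) 0 0

/-- The lift `B̃ ∈ 𝔤₀ ⊂ sl(m+1,ℝ)` of `B ∈ gl(m,ℝ)`, with `ψ(B̃) = B`. -/
def BTilde (B : GLm m) : Matrix (Idx m) (Idx m) ℝ :=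
  Matrix.fromBlocks
    (LinearMap.toMatrix' (B : (Fin m → ℝ) →ₗ[ℝ] (Fin m → ℝ))
      - ((LinearMap.trace ℝ (Rm m) (B : (Fin m → ℝ) →ₗ[ℝ] (Fin m → ℝ))) / ((m : ℝ) + 1)) • 1)
    0 0
    (Matrix.of fun _ _ => -(LinearMap.trace ℝ (Rm m) (B : (Fin m → ℝ) →ₗ[ℝ] (Fin m → ℝ))) / ((m : ℝ) + 1))

/-- The map `ψ : 𝔤₀ → gl(m,ℝ) : [[A,0],[0,a]] ↦ A - a·Id`. -/
def psiC (M : Matrix (Idx m) (Idx m) ℝ) : GLm m :=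
  LinearMap.toContinuousLinearMap
    ((Matrix.of fun i j => M (Sum.inl i) (Sum.inl j)).mulVecLin
      - M (Sum.inr ()) (Sum.inr ()) • LinearMap.id)

/-- The basis `(eᵢ)` of `𝔤₋₁`, corresponding to the standard basis of `ℝ^m`. -/
def eMat (i : Fin m) : Matrix (Idx m) (Idx m) ℝ := XMat m (Pi.single i 1)

/-- The covector `εⁱ = (1/(2(m+1))) δⁱ ∈ ℝ^{m*}`. -/
def epsD (i : Fin m) : Dualm m := (1 / (2 * ((m : ℝ) + 1))) • coordD m i

/-- The basis `(εⁱ)` of `𝔤₁`, Killing-dual to `(eᵢ)`. -/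
def epsMat (i : Fin m) : Matrix (Idx m) (Idx m) ℝ := hMat m (epsD m i)

/-- The Euler element `E = diag(-1/(m+1), …, -1/(m+1), m/(m+1)) ∈ 𝔤₀`, with `ψ(E) = -Id`. -/
def EMat : Matrix (Idx m) (Idx m) ℝ :=
  Matrix.fromBlocks ((-(1 / ((m : ℝ) + 1))) • 1) 0 0 (Matrix.of fun _ _ => (m : ℝ) / ((m : ℝ) + 1))

/-- Membership in `𝔰 ≅ sl(m,ℝ) ⊂ 𝔤₀`: block diagonal with vanishing corner and traceless. -/
def inS (M : Matrix (Idx m) (Idx m) ℝ) : Prop :=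
  (∀ i, M (Sum.inl i) (Sum.inr ()) = 0) ∧ (∀ j, M (Sum.inr ()) (Sum.inl j) = 0) ∧
    M (Sum.inr ()) (Sum.inr ()) = 0 ∧ Matrix.trace M = 0

/-- Membership in `𝔤₋₁`: only the `v`-block is nonzero. -/
def inGm1 (M : Matrix (Idx m) (Idx m) ℝ) : Prop :=
  (∀ i j, M (Sum.inl i) (Sum.inl j) = 0) ∧ (∀ j, M (Sum.inr ()) (Sum.inl j) = 0) ∧
    M (Sum.inr ()) (Sum.inr ()) = 0

/-- Membership in `𝔤₁`: only the `ξ`-block is nonzero. -/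
def inG1 (M : Matrix (Idx m) (Idx m) ℝ) : Prop :=
  (∀ i j, M (Sum.inl i) (Sum.inl j) = 0) ∧ (∀ i, M (Sum.inl i) (Sum.inr ()) = 0) ∧
    M (Sum.inr ()) (Sum.inr ()) = 0

/-- Membership in `𝔤₀`: block diagonal. -/
def inG0 (M : Matrix (Idx m) (Idx m) ℝ) : Prop :=
  (∀ i, M (Sum.inl i) (Sum.inr ()) = 0) ∧ (∀ j, M (Sum.inr ()) (Sum.inl j) = 0)

/-- The Killing form of `sl(m+1,ℝ)`: `κ(M,N) = 2(m+1) tr(MN)`. -/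
def kappa (M N : Matrix (Idx m) (Idx m) ℝ) : ℝ := 2 * ((m : ℝ) + 1) * Matrix.trace (M * N)

end Matrices

section SymbolOperators

variable (m : ℕ) (V₁ V₂ : Type)
  [NormedAddCommGroup V₁] [NormedSpace ℝ V₁] [NormedAddCommGroup V₂] [NormedSpace ℝ V₂]
  (σ₁ : GLm m →ₗ[ℝ] (V₁ →L[ℝ] V₁)) (σ₂ : GLm m →ₗ[ℝ] (V₂ →L[ℝ] V₂))

/-- The operator `C₀ = (1/2)σ^{(k)}(Id) + (1/2m)σ^{(k)}(Id)² + Σ_s σ^{(k)}(ψ(h_s))∘σ^{(k)}(ψ(h_s^*))`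
on `S^k ℝ^m ⊗ Hom(V₁,V₂)`. -/
def C0op {k : ℕ} {n : ℕ} (hs hs' : Fin n → Matrix (Idx m) (Idx m) ℝ)
    (T : Symb m V₁ V₂ k) : Symb m V₁ V₂ k :=
  (1/2 : ℝ) • sigmaS m V₁ V₂ σ₁ σ₂ (ContinuousLinearMap.id ℝ (Rm m)) T
  + (1/(2*(m : ℝ))) • sigmaS m V₁ V₂ σ₁ σ₂ (ContinuousLinearMap.id ℝ (Rm m))
      (sigmaS m V₁ V₂ σ₁ σ₂ (ContinuousLinearMap.id ℝ (Rm m)) T)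
  + ∑ s, sigmaS m V₁ V₂ σ₁ σ₂ (psiC m (hs s)) (sigmaS m V₁ V₂ σ₁ σ₂ (psiC m (hs' s)) T)

/-- `C₀` acting degreewise on `⊕_{k=0}^K S^k ℝ^m ⊗ Hom(V₁,V₂)`. -/
def C0tot {K : ℕ} {n : ℕ} (hs hs' : Fin n → Matrix (Idx m) (Idx m) ℝ)
    (T : SymbT m V₁ V₂ K) : SymbT m V₁ V₂ K :=
  fun k => C0op m V₁ V₂ σ₁ σ₂ hs hs' (T k)

/-- The operator `𝓛_M = L_{X^M} + γ(ξ_M)` (flat curly Lie derivative) on functions with values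
in `⊕_{k=0}^K S^k ℝ^m ⊗ Hom(V₁,V₂)`, where `ξ_M` is the `𝔤₁`-component of `M`. -/
def curlyL {K : ℕ} (γf : ∀ k : ℕ, Dualm m → (Symb m V₁ V₂ (k+1) →ₗ[ℝ] Symb m V₁ V₂ k))
    (M : Matrix (Idx m) (Idx m) ℝ) (f : Rm m → SymbT m V₁ V₂ K) : Rm m → SymbT m V₁ V₂ K :=
  fun x => lieD m (fun B T => sigmaT m V₁ V₂ σ₁ σ₂ B T) (projVF m M) f x
    + gTot m V₁ V₂ γf (∑ j, M (Sum.inr ()) (Sum.inl j) • coordD m j) (f x)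

end SymbolOperators

section Curved

variable (m : ℕ) (P : Type) [NormedAddCommGroup P] [NormedSpace ℝ P]

/-- The invariant derivative `L_{ω^{-1}(Z)} f` along the `ω`-constant vector field `η Z`. -/
def LD (η : Matrix (Idx m) (Idx m) ℝ → P → P) (Z : Matrix (Idx m) (Idx m) ℝ)
    {V : Type} [NormedAddCommGroup V] [NormedSpace ℝ V] (f : P → V) : P → V :=
  fun u => fderiv ℝ f u (η Z u)

/-- The bracket compatibility satisfied by a normal Cartan connection: for `M ∈ 𝔤₀ ⊕ 𝔤₁` and
`N ∈ 𝔤₋₁`, `L_{ω^{-1}(M)} ∘ L_{ω^{-1}(N)} - L_{ω^{-1}(N)} ∘ L_{ω^{-1}(M)} = L_{ω^{-1}([M,N])}` on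
smooth vector-space-valued functions. -/
def BracketCompat (η : Matrix (Idx m) (Idx m) ℝ → P → P) : Prop :=
  ∀ (V : Type) [NormedAddCommGroup V] [NormedSpace ℝ V],
    ∀ f : P → V, ContDiff ℝ (⊤ : ℕ∞) f →
      ∀ M N : Matrix (Idx m) (Idx m) ℝ, Matrix.trace M = 0 → Matrix.trace N = 0 →
        (∀ i, M (Sum.inl i) (Sum.inr ()) = 0) → inGm1 m N →
        (LD m P η M (LD m P η N f) - LD m P η N (LD m P η M f)) = LD m P η (M * N - N * M) f

/-- Infinitesimal `G₀`-equivariance of `f : P → V` with respect to `σ`: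
`L_{ω^{-1}(B̃)} f = -σ(B) f` for all `B ∈ gl(m,ℝ)`. -/
def equivG0 (η : Matrix (Idx m) (Idx m) ℝ → P → P)
    {V : Type} [NormedAddCommGroup V] [NormedSpace ℝ V]
    (σ : GLm m → V → V) (f : P → V) : Prop :=
  ∀ B : GLm m, LD m P η (BTilde m B) f = fun u => -(σ B (f u))

/-- Iterated invariant derivatives along `𝔤₋₁`-constant fields. -/
def iterL (η : Matrix (Idx m) (Idx m) ℝ → P → P)
    {V : Type} [NormedAddCommGroup V] [NormedSpace ℝ V] :
    (k : ℕ) → (Fin k → Rm m) → (P → V) → (P → V)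
  | 0, _, f => f
  | (k+1), v, f => LD m P η (XMat m (v 0)) (iterL η k (fun j => v j.succ) f)

/-- The symmetrized iterated invariant differential `(∇^ω)^k f`, evaluated on
`(X₁, …, X_k) ∈ (ℝ^m)^k`. -/
def nabK (η : Matrix (Idx m) (Idx m) ℝ → P → P)
    {V : Type} [NormedAddCommGroup V] [NormedSpace ℝ V]
    (k : ℕ) (f : P → V) (v : Fin k → Rm m) : P → V :=
  fun u => (k.factorial : ℝ)⁻¹ • ∑ ν : Equiv.Perm (Fin k), iterL m P η k (v ∘ ν) f u

variable (V₁ V₂ : Type)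
  [NormedAddCommGroup V₁] [NormedSpace ℝ V₁] [NormedAddCommGroup V₂] [NormedSpace ℝ V₂]

/-- The curved quantization map: `Q_ω(T)(f)(u) = ⟨T(u), (∇^ω)^k f(u)⟩` (full contraction). -/
def Qom (η : Matrix (Idx m) (Idx m) ℝ → P → P) {k : ℕ}
    (T : P → Symb m V₁ V₂ k) (f : P → V₁) : P → V₂ :=
  fun u => (k.factorial : ℝ)⁻¹ • ∑ d : Fin k → Fin m,
    (T u (fun t => coordD m (d t))) (nabK m P η k f (fun t => Pi.single (d t) 1) u)


/-- The curved operator `N^ω f = -2 Σᵢ γ(εⁱ)(L_{ω^{-1}(eᵢ)} f)`. -/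
def Nom {K : ℕ} (γf : ∀ k : ℕ, Dualm m → (Symb m V₁ V₂ (k+1) →ₗ[ℝ] Symb m V₁ V₂ k))
    (η : Matrix (Idx m) (Idx m) ℝ → P → P) (f : P → SymbT m V₁ V₂ K) : P → SymbT m V₁ V₂ K :=
  fun u => (-2 : ℝ) • ∑ i : Fin m, gTot m V₁ V₂ γf (epsD m i)
    (LD m P η (XMat m (Pi.single i 1)) f u)

end Curved

section SymmetricPowers

variable {m : ℕ} {V₁ V₂ : Type}
  [NormedAddCommGroup V₁] [NormedSpace ℝ V₁] [NormedAddCommGroup V₂] [NormedSpace ℝ V₂]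

instance finiteDimensional_symb [FiniteDimensional ℝ V₁] [FiniteDimensional ℝ V₂] (k : ℕ) :
    FiniteDimensional ℝ (Symb m V₁ V₂ k) :=
  Module.Finite.of_injective
    (ContinuousMultilinearMap.toMultilinearMapLinear :
      Symb m V₁ V₂ k →ₗ[ℝ] MultilinearMap ℝ (fun _ : Fin k => Dualm m) (V₁ →L[ℝ] V₂))
    ContinuousMultilinearMap.toMultilinearMap_injective

/-- The decomposable tensor `h₁ ⊗ ⋯ ⊗ h_k ⊗ A` as a multilinear map of `h₁, …, h_k`. -/
def tensorCMM (k : ℕ) (A : V₁ →L[ℝ] V₂) :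
    ContinuousMultilinearMap ℝ (fun _ : Fin k => Rm m) (Symb m V₁ V₂ k) :=
  (ContinuousMultilinearMap.compContinuousLinearMapLRight
    (ContinuousMultilinearMap.mkPiRing ℝ (Fin k) A)).compContinuousLinearMap
      (fun _ => ContinuousLinearMap.apply ℝ ℝ)

lemma tensorCMM_apply {k : ℕ} (A : V₁ →L[ℝ] V₂) (v : Fin k → Rm m) :
    tensorCMM k A v = pureT m V₁ V₂ v A := rfl

lemma pureT_apply {k : ℕ} (v : Fin k → Rm m) (A : V₁ →L[ℝ] V₂) (l : Fin k → Dualm m) :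
    pureT m V₁ V₂ v A l = (∏ t, l t (v t)) • A := by
  simp [pureT]

/-- The power `v ⊗ ⋯ ⊗ v ⊗ A`. -/
def powT (k : ℕ) (v : Rm m) (A : V₁ →L[ℝ] V₂) : Symb m V₁ V₂ k :=
  pureT m V₁ V₂ (fun _ => v) A

/-- The derivative of `v ↦ v ⊗ ⋯ ⊗ v ⊗ A` in the direction `w`. -/
def dpowT (k : ℕ) (v w : Rm m) (A : V₁ →L[ℝ] V₂) : Symb m V₁ V₂ k :=
  ∑ t, pureT m V₁ V₂ (Function.update (fun _ => v) t w) A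

lemma powT_apply {k : ℕ} (v : Rm m) (A : V₁ →L[ℝ] V₂) (l : Fin k → Dualm m) :
    powT k v A l = (∏ t, l t v) • A := pureT_apply _ _ _

lemma powT_add {k : ℕ} (v : Rm m) (A B : V₁ →L[ℝ] V₂) :
    powT k v (A + B) = powT k v A + powT k v B := by
  ext1 l; simp [powT_apply]

lemma powT_sub {k : ℕ} (v : Rm m) (A B : V₁ →L[ℝ] V₂) :
    powT k v (A - B) = powT k v A - powT k v B := by
  ext1 l; simp [powT_apply, smul_sub]

lemma powT_smul {k : ℕ} (v : Rm m) (c : ℝ) (A : V₁ →L[ℝ] V₂) :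
    powT k v (c • A) = c • powT k v A := by
  ext1 l; simp [powT_apply, smul_comm c]

lemma hasDerivAt_powT (k : ℕ) (v w : Rm m) (A : V₁ →L[ℝ] V₂) :
    HasDerivAt (fun s : ℝ => powT k (v + s • w) A) (dpowT k v w A) 0 := by
  have h1 : HasDerivAt (fun s : ℝ => (fun _ : Fin k => v + s • w)) (fun _ => w) 0 := by
    rw [hasDerivAt_pi]
    intro _
    simpa using ((hasDerivAt_id (0 : ℝ)).smul_const w).const_add v
  have h2 := ContinuousMultilinearMap.hasFDerivAt (𝕜 := ℝ) (ι := Fin k)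
    (E := fun _ => Rm m) (F := Symb m V₁ V₂ k) (tensorCMM (m := m) k A) (fun _ : Fin k => v + (0 : ℝ) • w)
  have h3 := h2.comp_hasDerivAt (0 : ℝ) h1
  refine h3.congr_deriv ?_
  simp [ContinuousMultilinearMap.linearDeriv_apply, tensorCMM_apply, dpowT]

lemma symT_const {k : ℕ} (v : Rm m) (A : V₁ →L[ℝ] V₂) :
    symT m V₁ V₂ (fun _ : Fin k => v) A = (k.factorial : ℝ) • powT k v A := by
  have : ∀ ν : Equiv.Perm (Fin k), ((fun _ : Fin k => v) ∘ ν) = fun _ => v := fun _ => rfl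
  simp [symT, this, powT, Fintype.card_perm, ← Nat.cast_smul_eq_nsmul ℝ]

lemma symT_update_const {k : ℕ} (v : Rm m) (j : Fin k) (c : ℝ) (A : V₁ →L[ℝ] V₂) :
    symT m V₁ V₂ (Function.update (fun _ : Fin k => v) j (c • v)) A
      = c • symT m V₁ V₂ (fun _ : Fin k => v) A := by
  rw [symT, symT, Finset.smul_sum]
  refine Finset.sum_congr rfl fun ν _ => ?_
  have h : (Function.update (fun _ : Fin k => v) j (c • v)) ∘ ν
      = Function.update (fun _ : Fin k => v) (ν.symm j) (c • v) := by
    ext1 t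
    by_cases ht : ν t = j
    · subst ht; simp
    · have : t ≠ ν.symm j := fun h => ht (by simp [h])
      simp [Function.update_of_ne, ht, this]
  rw [h, ← tensorCMM_apply, ContinuousMultilinearMap.map_update_smul, tensorCMM_apply]
  simp; rfl

lemma spanGen_le_span_powT [FiniteDimensional ℝ V₁] [FiniteDimensional ℝ V₂] (k : ℕ) :
    spanGen m V₁ V₂ k
      ≤ Submodule.span ℝ {T | ∃ (v : Rm m) (A : V₁ →L[ℝ] V₂), T = powT k v A} := by
  rw [spanGen, Submodule.span_le]
  rintro _ ⟨v, A, rfl⟩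
  by_contra hv
  rw [SetLike.mem_coe] at hv
  obtain ⟨φ, hφ, hle⟩ :=
    Submodule.exists_le_ker_of_notMem (K := ℝ) (V := Symb m V₁ V₂ k) hv
  apply hφ
  let φ' : Symb m V₁ V₂ k →L[ℝ] ℝ :=
    LinearMap.toContinuousLinearMap (𝕜 := ℝ) (E := Symb m V₁ V₂ k) (F' := ℝ) φ
  let P : ContinuousMultilinearMap ℝ (fun _ : Fin k => Rm m) ℝ :=
    φ'.compContinuousMultilinearMap (tensorCMM (m := m) k A)
  have h1 := P.iteratedFDeriv_comp_diagonal 0 v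
  have h0 : (fun x : Rm m => P (fun _ => x)) = fun _ => 0 := by
    funext x
    exact hle (Submodule.subset_span ⟨x, A, rfl⟩)
  rw [h0] at h1
  have h2 : φ (symT m V₁ V₂ v A) = iteratedFDeriv ℝ k (fun _ : Rm m => (0 : ℝ)) 0 v := by
    rw [h1, symT, map_sum]; rfl
  rw [h2]
  change iteratedFDeriv ℝ k (0 : Rm m → ℝ) 0 v = 0
  simp

lemma spanGen_induction [FiniteDimensional ℝ V₁] [FiniteDimensional ℝ V₂] {k : ℕ}
    {E : Type*} [AddCommMonoid E] [Module ℝ E] (F G : Symb m V₁ V₂ k →ₗ[ℝ] E)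
    (h : ∀ v A, F (powT k v A) = G (powT k v A)) {T : Symb m V₁ V₂ k}
    (hT : T ∈ spanGen m V₁ V₂ k) : F T = G T := by
  refine LinearMap.eqOn_span (s := {T | ∃ (v : Rm m) (A : V₁ →L[ℝ] V₂), T = powT k v A}) ?_
    (spanGen_le_span_powT k hT)
  rintro _ ⟨v, A, rfl⟩
  exact h v A

end SymmetricPowers

lemma linearMap_apply_deriv_eq {E F : Type*} [NormedAddCommGroup E] [NormedSpace ℝ E]
    [FiniteDimensional ℝ E] [NormedAddCommGroup F] [NormedSpace ℝ F] (L : E →ₗ[ℝ] F)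
    {c : ℝ → E} {a b : ℝ → F} {c' : E} {a' b' : F} (hc : HasDerivAt c c' 0)
    (ha : HasDerivAt a a' 0) (hb : HasDerivAt b b' 0) (h : ∀ s, L (c s) = a s + s • b s) :
    L c' = a' + b 0 := by
  have h1 : HasDerivAt (fun s => L (c s)) (L c') 0 :=
    (LinearMap.toContinuousLinearMap L).hasFDerivAt.comp_hasDerivAt (0 : ℝ) hc
  have h2 := ha.add ((hasDerivAt_id (0 : ℝ)).smul hb)
  rw [funext h] at h1
  simpa using h1.unique h2

section GammaAlgebra

variable {m : ℕ} {V₁ V₂ : Type}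
  [NormedAddCommGroup V₁] [NormedSpace ℝ V₁] [NormedAddCommGroup V₂] [NormedSpace ℝ V₂]
  {σ₁ : GLm m →ₗ[ℝ] (V₁ →L[ℝ] V₁)} {σ₂ : GLm m →ₗ[ℝ] (V₂ →L[ℝ] V₂)}

variable (σ₁) in
/-- The endomorphism `σ₁(v⊗h + h(v)·Id) - k·h(v)·Id` of `V₁` through which `γ(h)` acts on powers
of `v`. -/
def tau (k : ℕ) (v : Rm m) (h : Dualm m) : V₁ →L[ℝ] V₁ :=
  σ₁ (rkOne m v h + h v • ContinuousLinearMap.id ℝ (Rm m))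
    - ((k : ℝ) * h v) • ContinuousLinearMap.id ℝ V₁

lemma rkOne_add_left (v w : Rm m) (h : Dualm m) :
    rkOne m (v + w) h = rkOne m v h + rkOne m w h := by
  ext1 x; simp [rkOne]

lemma rkOne_smul_left (c : ℝ) (v : Rm m) (h : Dualm m) :
    rkOne m (c • v) h = c • rkOne m v h := by
  ext1 x; simp [rkOne, smul_comm c]

lemma rkOne_add_right (v : Rm m) (h h' : Dualm m) :
    rkOne m v (h + h') = rkOne m v h + rkOne m v h' := by
  ext1 x; simp [rkOne, add_smul]

lemma tau_add_left (k : ℕ) (v w : Rm m) (h : Dualm m) :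
    tau σ₁ k (v + w) h = tau σ₁ k v h + tau σ₁ k w h := by
  simp only [tau, rkOne_add_left, map_add, add_smul, mul_add]
  abel

lemma tau_smul_left (k : ℕ) (c : ℝ) (v : Rm m) (h : Dualm m) :
    tau σ₁ k (c • v) h = c • tau σ₁ k v h := by
  simp only [tau, rkOne_smul_left, map_add, map_smul, smul_eq_mul, mul_smul]
  module

lemma tau_add_right (k : ℕ) (v : Rm m) (h h' : Dualm m) :
    tau σ₁ k v (h + h') = tau σ₁ k v h + tau σ₁ k v h' := by
  simp only [tau, rkOne_add_right, map_add, add_smul, mul_add, add_apply]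
  abel

lemma sum_succAbove_lt {k : ℕ} (i : Fin (k + 1)) :
    ∑ j : Fin k, (if (i.succAbove j : ℕ) < (i : ℕ) then (1 : ℝ) else 0) = (i : ℕ) := by
  have h : ∑ j : Fin (k + 1), (if (j : ℕ) < (i : ℕ) then (1 : ℝ) else 0) = (i : ℕ) := by
    rw [Finset.sum_boole]
    rw [← Fin.card_Iio i]
    congr 2
    ext j
    simp
  rw [← h, Fin.sum_univ_succAbove _ i]
  simp

lemma gamma_powT {k : ℕ} {γ : Dualm m → (Symb m V₁ V₂ (k+1) →ₗ[ℝ] Symb m V₁ V₂ k)}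
    (hγ : gammaProp m V₁ V₂ σ₁ γ) (h : Dualm m) (v : Rm m) (A : V₁ →L[ℝ] V₂) :
    γ h (powT (k + 1) v A) = powT k v (A ∘L tau σ₁ k v h) := by
  have key := hγ h (fun _ => v) A
  have e1 : ∀ i : Fin (k + 1), i.removeNth (fun _ : Fin (k + 1) => v) = fun _ => v :=
    fun i => rfl
  have e2 : ∀ (i : Fin (k + 1)) (j : Fin k) (w : Rm m),
      i.removeNth (Function.update (fun _ : Fin (k + 1) => v) (i.succAbove j) w)
        = Function.update (fun _ : Fin k => v) j w := by
    intro i j w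
    ext1 t
    by_cases ht : t = j
    · subst ht; simp [Fin.removeNth]
    · simp [Fin.removeNth, ht, Function.update_of_ne]
  have e3 : ∑ i : Fin (k + 1), ((i : ℕ) : ℝ) = ((k : ℝ) + 1) * k / 2 := by
    rw [Fin.sum_univ_eq_sum_range (fun i => (i : ℝ)), ← Nat.cast_sum]
    have := Finset.sum_range_id_mul_two (k + 1)
    have h2 : ((∑ i ∈ Finset.range (k + 1), i : ℕ) : ℝ) * 2 = (k + 1) * k := by
      exact_mod_cast this
    linarith
  have e4 : h v • v + h v • v = (2 * h v) • v := by module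
  have e5 : ∀ (i : Fin (k + 1)) (j : Fin k) (S : Symb m V₁ V₂ k),
      (if (i.succAbove j : ℕ) < (i : ℕ) then S else 0)
        = (if (i.succAbove j : ℕ) < (i : ℕ) then (1 : ℝ) else 0) • S := by
    intro i j S
    split_ifs
    · exact (one_smul ℝ S).symm
    · exact (zero_smul ℝ S).symm
  simp only [e1, e2, e4, symT_update_const, symT_const, map_smul] at key
  simp only [e5, ← Finset.sum_smul, sum_succAbove_lt, e3] at key
  have hk : (((k + 1).factorial : ℕ) : ℝ) ≠ 0 := by positivity
  apply smul_right_injective _ hk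
  beta_reduce
  rw [key, tau, ContinuousLinearMap.comp_sub, ContinuousLinearMap.comp_smul,
    ContinuousLinearMap.comp_id, powT_sub, powT_smul, Nat.factorial_succ]
  simp only [Finset.sum_const, Finset.card_univ, Fintype.card_fin, ← Nat.cast_smul_eq_nsmul ℝ]
  push_cast
  module

lemma sigmaS_apply {k : ℕ} (B : GLm m) (T : Symb m V₁ V₂ k) (l : Fin k → Dualm m) :
    sigmaS m V₁ V₂ σ₁ σ₂ B T l = ∑ t, T (Function.update l t ((l t).comp B))
      + ((σ₂ B).comp (T l) - (T l).comp (σ₁ B)) := by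
  have : ∀ t : Fin k, (fun s => (if s = t then
      (ContinuousLinearMap.compL ℝ (Rm m) (Rm m) ℝ).flip B
      else ContinuousLinearMap.id ℝ (Dualm m)) (l s)) = Function.update l t ((l t).comp B) := by
    intro t
    ext1 s
    by_cases hs : s = t
    · subst hs; simp
    · simp [hs, Function.update_of_ne]
  simp [sigmaS, this]

lemma sigmaS_powT {k : ℕ} (B : GLm m) (v : Rm m) (A : V₁ →L[ℝ] V₂) :
    sigmaS m V₁ V₂ σ₁ σ₂ B (powT k v A)
      = dpowT k v (B v) A + powT k v ((σ₂ B).comp A - A.comp (σ₁ B)) := by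
  ext1 l
  have : ∀ t : Fin k, ∏ s, Function.update l t ((l t).comp B) s v
      = ∏ s, l s (Function.update (fun _ => v) t (B v) s) := by
    intro t
    refine Finset.prod_congr rfl fun s _ => ?_
    by_cases hs : s = t
    · subst hs; simp
    · simp [hs, Function.update_of_ne]
  simp [sigmaS_apply, powT_apply, dpowT, pureT_apply, this, smul_sub]

/-- The operator `σ^{(k)}(B)` as a bilinear map in `B` and the symbol. -/
def sigmaBilin (σ₁ : GLm m →ₗ[ℝ] (V₁ →L[ℝ] V₁)) (σ₂ : GLm m →ₗ[ℝ] (V₂ →L[ℝ] V₂)) (k : ℕ) :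
    GLm m →ₗ[ℝ] Symb m V₁ V₂ k →ₗ[ℝ] Symb m V₁ V₂ k :=
  LinearMap.mk₂ ℝ (fun B T => sigmaS m V₁ V₂ σ₁ σ₂ B T)
    (fun B C T => by
      ext1 l
      simp only [sigmaS_apply, add_apply, ContinuousLinearMap.comp_add,
        ContinuousMultilinearMap.map_update_add, Finset.sum_add_distrib, map_add,
        ContinuousLinearMap.add_comp]
      abel)
    (fun c B T => by
      ext1 l
      simp only [sigmaS_apply, smul_apply, ContinuousLinearMap.comp_smul,
        ContinuousMultilinearMap.map_update_smul, ← Finset.smul_sum, map_smul,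
        ContinuousLinearMap.smul_comp, smul_add, smul_sub])
    (fun B T S => by
      ext1 l
      simp only [sigmaS_apply, add_apply, ContinuousLinearMap.comp_add,
        Finset.sum_add_distrib, ContinuousLinearMap.add_comp]
      abel)
    (fun c B T => by
      ext1 l
      simp only [sigmaS_apply, smul_apply, ContinuousLinearMap.comp_smul,
        ← Finset.smul_sum, ContinuousLinearMap.smul_comp, smul_add, smul_sub])

lemma sigmaBilin_apply {k : ℕ} (B : GLm m) (T : Symb m V₁ V₂ k) :
    sigmaBilin σ₁ σ₂ k B T = sigmaS m V₁ V₂ σ₁ σ₂ B T := rfl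

lemma sigmaS_bracket (hσ₁ : IsLieRep m σ₁) (hσ₂ : IsLieRep m σ₂) {k : ℕ} (B C : GLm m)
    (T : Symb m V₁ V₂ k) :
    sigmaS m V₁ V₂ σ₁ σ₂ B (sigmaS m V₁ V₂ σ₁ σ₂ C T)
      - sigmaS m V₁ V₂ σ₁ σ₂ C (sigmaS m V₁ V₂ σ₁ σ₂ B T)
      = sigmaS m V₁ V₂ σ₁ σ₂ (B ∘L C - C ∘L B) T := by
  ext1 l
  have hpair : ∀ s t : Fin k,
      T (Function.update (Function.update l t ((l t).comp B)) s
          ((Function.update l t ((l t).comp B) s).comp C))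
        - T (Function.update (Function.update l s ((l s).comp C)) t
          ((Function.update l s ((l s).comp C) t).comp B))
      = if s = t then T (Function.update l t ((l t).comp (B ∘L C - C ∘L B))) else 0 := by
    intro s t
    by_cases hst : s = t
    · subst hst
      simp [ContinuousLinearMap.comp_sub, ContinuousMultilinearMap.map_update_sub,
        ContinuousLinearMap.comp_assoc]
    · rw [Function.update_of_ne hst, Function.update_of_ne (Ne.symm hst),
        Function.update_comm hst, if_neg hst, sub_self]
  have hsum : ∑ t, ∑ s, T (Function.update (Function.update l t ((l t).comp B)) s
          ((Function.update l t ((l t).comp B) s).comp C))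
        - ∑ t, ∑ s, T (Function.update (Function.update l t ((l t).comp C)) s
          ((Function.update l t ((l t).comp C) s).comp B))
      = ∑ t, T (Function.update l t ((l t).comp (B ∘L C - C ∘L B))) := by
    rw [Finset.sum_comm (f := fun t s => T (Function.update (Function.update l t ((l t).comp C)) s
          ((Function.update l t ((l t).comp C) s).comp B))), ← Finset.sum_sub_distrib]
    refine Finset.sum_congr rfl fun t _ => ?_
    rw [← Finset.sum_sub_distrib, Finset.sum_congr rfl fun s _ => hpair s t]
    simp
  simp only [sub_apply, sigmaS_apply]
  rw [← hsum, hσ₁, hσ₂]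
  simp only [Finset.sum_add_distrib, Finset.sum_sub_distrib, ContinuousLinearMap.comp_add,
    ContinuousLinearMap.add_comp, ContinuousLinearMap.comp_sub, ContinuousLinearMap.sub_comp,
    ContinuousLinearMap.comp_finsetSum, ContinuousLinearMap.finsetSum_comp,
    ContinuousLinearMap.comp_assoc]
  abel

lemma sigma_tau (hσ₁ : IsLieRep m σ₁) (k : ℕ) (B : GLm m) (v : Rm m) (h : Dualm m) :
    (σ₁ B) ∘L tau σ₁ k v h - tau σ₁ k v h ∘L (σ₁ B)
      = tau σ₁ k (B v) h - tau σ₁ k v (h ∘L B) := by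
  have e : B ∘L (rkOne m v h + h v • ContinuousLinearMap.id ℝ (Rm m))
      - (rkOne m v h + h v • ContinuousLinearMap.id ℝ (Rm m)) ∘L B
      = rkOne m (B v) h - rkOne m v (h ∘L B) := by
    ext1 x; simp [rkOne]
  have h1 := hσ₁ B (rkOne m v h + h v • ContinuousLinearMap.id ℝ (Rm m))
  rw [e, map_sub] at h1
  simp only [tau, ContinuousLinearMap.comp_sub, ContinuousLinearMap.sub_comp,
    ContinuousLinearMap.comp_smul, ContinuousLinearMap.smul_comp, ContinuousLinearMap.comp_id,
    ContinuousLinearMap.id_comp, map_add, ContinuousLinearMap.comp_apply] at h1 ⊢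
  have h2 := sub_eq_iff_eq_add.1 h1
  rw [h2]
  abel

lemma tau_comm (hσ₁ : IsLieRep m σ₁) (k : ℕ) (v : Rm m) (h h' : Dualm m) :
    tau σ₁ (k + 1) v h ∘L tau σ₁ k v h' = tau σ₁ (k + 1) v h' ∘L tau σ₁ k v h := by
  have e : (rkOne m v h + h v • ContinuousLinearMap.id ℝ (Rm m))
        ∘L (rkOne m v h' + h' v • ContinuousLinearMap.id ℝ (Rm m))
      - (rkOne m v h' + h' v • ContinuousLinearMap.id ℝ (Rm m))
        ∘L (rkOne m v h + h v • ContinuousLinearMap.id ℝ (Rm m))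
      = h v • (rkOne m v h' + h' v • ContinuousLinearMap.id ℝ (Rm m))
        - h' v • (rkOne m v h + h v • ContinuousLinearMap.id ℝ (Rm m)) := by
    ext1 x
    simp [rkOne]
    module
  have h1 := hσ₁ (rkOne m v h + h v • ContinuousLinearMap.id ℝ (Rm m))
    (rkOne m v h' + h' v • ContinuousLinearMap.id ℝ (Rm m))
  rw [e, map_sub, map_smul, map_smul] at h1
  simp only [tau, ContinuousLinearMap.comp_sub, ContinuousLinearMap.sub_comp,
    ContinuousLinearMap.comp_smul, ContinuousLinearMap.smul_comp, ContinuousLinearMap.comp_id,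
    ContinuousLinearMap.id_comp]
  rw [← sub_eq_zero] at h1 ⊢
  rw [← neg_eq_zero, ← h1]
  push_cast
  module

variable [FiniteDimensional ℝ V₁] [FiniteDimensional ℝ V₂]

lemma gamma_dpowT {k : ℕ} {γ : Dualm m → (Symb m V₁ V₂ (k+1) →ₗ[ℝ] Symb m V₁ V₂ k)}
    (hγ : gammaProp m V₁ V₂ σ₁ γ) (h : Dualm m) (v w : Rm m) (A : V₁ →L[ℝ] V₂) :
    γ h (dpowT (k + 1) v w A)
      = dpowT k v w (A ∘L tau σ₁ k v h) + powT k v (A ∘L tau σ₁ k w h) := by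
  have h1 := linearMap_apply_deriv_eq (E := Symb m V₁ V₂ (k + 1)) (F := Symb m V₁ V₂ k) (γ h)
    (hasDerivAt_powT (k + 1) v w A) (hasDerivAt_powT k v w (A ∘L tau σ₁ k v h))
    (hasDerivAt_powT k v w (A ∘L tau σ₁ k w h)) fun s => by
      rw [gamma_powT hγ, tau_add_left, tau_smul_left, ContinuousLinearMap.comp_add,
        ContinuousLinearMap.comp_smul, powT_add, powT_smul]
  rwa [zero_smul, add_zero] at h1

lemma gamma_equivariant (hσ₁ : IsLieRep m σ₁) {k : ℕ}
    {γ : Dualm m → (Symb m V₁ V₂ (k+1) →ₗ[ℝ] Symb m V₁ V₂ k)}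
    (hγ : gammaProp m V₁ V₂ σ₁ γ) (h : Dualm m) (B : GLm m) {T : Symb m V₁ V₂ (k+1)}
    (hT : T ∈ spanGen m V₁ V₂ (k+1)) :
    γ h (sigmaS m V₁ V₂ σ₁ σ₂ B T) = γ (h ∘L B) T + sigmaS m V₁ V₂ σ₁ σ₂ B (γ h T) := by
  refine spanGen_induction (γ h ∘ₗ sigmaBilin σ₁ σ₂ (k + 1) B)
    (γ (h ∘L B) + sigmaBilin σ₁ σ₂ k B ∘ₗ γ h) (fun v A => ?_) hT
  have e := sigma_tau hσ₁ k B v h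
  have e' : tau σ₁ k v (h ∘L B) = tau σ₁ k (B v) h
      - ((σ₁ B) ∘L tau σ₁ k v h - tau σ₁ k v h ∘L (σ₁ B)) := by rw [e]; abel
  simp only [LinearMap.add_apply, LinearMap.comp_apply, sigmaBilin_apply, sigmaS_powT,
    gamma_powT hγ, map_add, gamma_dpowT hγ, e']
  simp only [ContinuousLinearMap.comp_sub, ContinuousLinearMap.sub_comp, powT_sub,
    ContinuousLinearMap.comp_assoc]
  abel

lemma gamma_comm (hσ₁ : IsLieRep m σ₁) {k : ℕ}
    {γ : Dualm m → (Symb m V₁ V₂ (k+1) →ₗ[ℝ] Symb m V₁ V₂ k)}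
    {γ' : Dualm m → (Symb m V₁ V₂ (k+1+1) →ₗ[ℝ] Symb m V₁ V₂ (k+1))}
    (hγ : gammaProp m V₁ V₂ σ₁ γ) (hγ' : gammaProp m V₁ V₂ σ₁ γ') (h h' : Dualm m)
    {T : Symb m V₁ V₂ (k+1+1)} (hT : T ∈ spanGen m V₁ V₂ (k+1+1)) :
    γ h (γ' h' T) = γ h' (γ' h T) := by
  refine spanGen_induction (γ h ∘ₗ γ' h') (γ h' ∘ₗ γ' h) (fun v A => ?_) hT
  simp only [LinearMap.comp_apply, gamma_powT hγ, gamma_powT hγ', ContinuousLinearMap.comp_assoc,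
    tau_comm hσ₁ k v h h']

lemma gamma_add {k : ℕ} {γ : Dualm m → (Symb m V₁ V₂ (k+1) →ₗ[ℝ] Symb m V₁ V₂ k)}
    (hγ : gammaProp m V₁ V₂ σ₁ γ) (h h' : Dualm m) {T : Symb m V₁ V₂ (k+1)}
    (hT : T ∈ spanGen m V₁ V₂ (k+1)) : γ (h + h') T = γ h T + γ h' T := by
  refine spanGen_induction (γ (h + h')) (γ h + γ h') (fun v A => ?_) hT
  simp only [LinearMap.add_apply, gamma_powT hγ, tau_add_right, ContinuousLinearMap.comp_add,
    powT_add]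

end GammaAlgebra

section LieDerivativeWithPotential

variable {E W : Type*} [NormedAddCommGroup E] [NormedSpace ℝ E]
  [NormedAddCommGroup W] [NormedSpace ℝ W] [FiniteDimensional ℝ W]

lemma hasFDerivAt_bilin_apply {F : Type*} [NormedAddCommGroup F] [NormedSpace ℝ F]
    [FiniteDimensional ℝ F] (S : F →ₗ[ℝ] W →ₗ[ℝ] W) {b : E → F} {f : E → W}
    {b' : E →L[ℝ] F} {f' : E →L[ℝ] W} {x : E} (hb : HasFDerivAt b b' x)
    (hf : HasFDerivAt f f' x) :
    ∃ L : E →L[ℝ] W, HasFDerivAt (fun y => S (b y) (f y)) L x ∧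
      ∀ u, L u = S (b x) (f' u) + S (b' u) (f x) := by
  let S' : F →L[ℝ] W →L[ℝ] W := LinearMap.toContinuousLinearMap
    ((LinearMap.toContinuousLinearMap : (W →ₗ[ℝ] W) ≃ₗ[ℝ] (W →L[ℝ] W)).toLinearMap ∘ₗ S)
  exact ⟨_, S'.hasFDerivAt_of_bilinear hb hf, fun u => rfl⟩

/-- The commutator of two operators `f ↦ Df(X) - S(DX) f + G f`. -/
lemma commutator_lie_add_potential [FiniteDimensional ℝ E] (S : (E →L[ℝ] E) →ₗ[ℝ] W →ₗ[ℝ] W) (G H : W →ₗ[ℝ] W)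
    {X Y : E → E} {X' Y' : E → E →L[ℝ] E} {X'' Y'' : E →L[ℝ] E →L[ℝ] E}
    {f : E → W} (hf : ContDiff ℝ 2 f) (x : E)
    (hX : HasFDerivAt X (X' x) x) (hY : HasFDerivAt Y (Y' x) x)
    (hX' : HasFDerivAt X' X'' x) (hY' : HasFDerivAt Y' Y'' x)
    (hS : S (X' x ∘L Y' x - Y' x ∘L X' x) (f x)
      = S (X' x) (S (Y' x) (f x)) - S (Y' x) (S (X' x) (f x)))
    (hGH : G (H (f x)) = H (G (f x))) {p q : W}
    (hG : G (S (Y' x) (f x)) = q + S (Y' x) (G (f x)))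
    (hH : H (S (X' x) (f x)) = p + q + S (X' x) (H (f x))) :
    (fderiv ℝ (fun y => fderiv ℝ f y (Y y) - S (Y' y) (f y) + H (f y)) x (X x)
        - S (X' x) (fderiv ℝ f x (Y x) - S (Y' x) (f x) + H (f x))
        + G (fderiv ℝ f x (Y x) - S (Y' x) (f x) + H (f x)))
      - (fderiv ℝ (fun y => fderiv ℝ f y (X y) - S (X' y) (f y) + G (f y)) x (Y x)
        - S (Y' x) (fderiv ℝ f x (X x) - S (X' x) (f x) + G (f x))
        + H (fderiv ℝ f x (X x) - S (X' x) (f x) + G (f x)))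
      = fderiv ℝ f x (Y' x (X x) - X' x (Y x))
        - S (Y'' (X x) - X'' (Y x) + (Y' x ∘L X' x - X' x ∘L Y' x)) (f x) + p := by
  have hd : HasFDerivAt f (fderiv ℝ f x) x :=
    (hf.differentiable (by norm_num) x).hasFDerivAt
  have hdd : HasFDerivAt (fderiv ℝ f) (fderiv ℝ (fderiv ℝ f) x) x :=
    ((hf.fderiv_right (m := 1) (by norm_num)).differentiable (by norm_num) x).hasFDerivAt
  have hsymm : ∀ u w, fderiv ℝ (fderiv ℝ f) x u w = fderiv ℝ (fderiv ℝ f) x w u :=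
    fun u w => (hf.contDiffAt.isSymmSndFDerivAt (by simp)) u w
  have key : ∀ (Z : E → E) (Z' : E → E →L[ℝ] E) (Z'' : E →L[ℝ] E →L[ℝ] E) (Q : W →ₗ[ℝ] W),
      HasFDerivAt Z (Z' x) x → HasFDerivAt Z' Z'' x → ∀ u,
      fderiv ℝ (fun y => fderiv ℝ f y (Z y) - S (Z' y) (f y) + Q (f y)) x u
        = fderiv ℝ (fderiv ℝ f) x u (Z x) + fderiv ℝ f x (Z' x u)
          - (S (Z' x) (fderiv ℝ f x u) + S (Z'' u) (f x)) + Q (fderiv ℝ f x u) := by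
    intro Z Z' Z'' Q hZ hZ' u
    obtain ⟨L, hL, hLu⟩ := hasFDerivAt_bilin_apply S hZ' hd
    have hQ : HasFDerivAt (fun y => Q (f y))
        ((LinearMap.toContinuousLinearMap Q) ∘L fderiv ℝ f x) x :=
      (LinearMap.toContinuousLinearMap Q).hasFDerivAt.comp x hd
    have hsum : HasFDerivAt (fun y => fderiv ℝ f y (Z y) - S (Z' y) (f y) + Q (f y)) _ x :=
      ((hdd.clm_apply hZ).sub hL).add hQ
    rw [hsum.fderiv]
    simp [hLu, add_comm]
  rw [key Y Y' Y'' H hY hY', key X X' X'' G hX hX', hsymm (Y x) (X x)]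
  have hS' : S (Y' x ∘L X' x - X' x ∘L Y' x) (f x)
      = S (Y' x) (S (X' x) (f x)) - S (X' x) (S (Y' x) (f x)) := by
    rw [← neg_sub (X' x ∘L Y' x), map_neg, LinearMap.neg_apply, hS]; abel
  simp only [map_add, map_sub, LinearMap.add_apply, LinearMap.sub_apply] at hS' ⊢
  rw [hS', hGH, hG, hH]
  abel

end LieDerivativeWithPotential

section ProjectiveVectorFields

variable {m : ℕ}

/-- The `𝔤₋₁`-component of a matrix. -/
def vecPart (M : Matrix (Idx m) (Idx m) ℝ) : Rm m := fun i => M (Sum.inl i) (Sum.inr ())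

/-- The `𝔤₁`-component of a matrix. -/
def covecPart (M : Matrix (Idx m) (Idx m) ℝ) : Dualm m :=
  ∑ j, M (Sum.inr ()) (Sum.inl j) • coordD m j

lemma covecPart_apply (M : Matrix (Idx m) (Idx m) ℝ) (x : Rm m) :
    covecPart M x = ∑ j, M (Sum.inr ()) (Sum.inl j) * x j := by
  simp [covecPart, coordD]

lemma psiC_apply (M : Matrix (Idx m) (Idx m) ℝ) (x : Rm m) :
    psiC m M x = M.toBlocks₁₁.mulVec x - M (Sum.inr ()) (Sum.inr ()) • x := rfl

lemma projVF_eq (M : Matrix (Idx m) (Idx m) ℝ) (x : Rm m) :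
    projVF m M x = -vecPart M - psiC m M x + covecPart M x • x := by
  ext i
  simp [projVF, vecPart, psiC_apply, covecPart_apply, Matrix.mulVec, dotProduct,
    Matrix.toBlocks₁₁]
  ring

lemma matrix_mul_apply_idx (M N : Matrix (Idx m) (Idx m) ℝ) (p q : Idx m) :
    (M * N) p q = ∑ j, M p (Sum.inl j) * N (Sum.inl j) q
      + M p (Sum.inr ()) * N (Sum.inr ()) q := by
  simp [Matrix.mul_apply]

lemma toBlocks₁₁_mul_mulVec (M N : Matrix (Idx m) (Idx m) ℝ) (x : Rm m) :
    (M * N).toBlocks₁₁.mulVec x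
      = M.toBlocks₁₁.mulVec (N.toBlocks₁₁.mulVec x) + covecPart N x • vecPart M := by
  have h : (M * N).toBlocks₁₁ = M.toBlocks₁₁ * N.toBlocks₁₁ + M.toBlocks₁₂ * N.toBlocks₂₁ := by
    ext i j
    simp [Matrix.toBlocks₁₁, Matrix.toBlocks₁₂, Matrix.toBlocks₂₁, Matrix.mul_apply]
  rw [h, Matrix.add_mulVec, Matrix.mulVec_mulVec]
  congr 1
  ext i
  simp [Matrix.mulVec, dotProduct, Matrix.toBlocks₁₂, Matrix.toBlocks₂₁, Matrix.mul_apply,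
    covecPart_apply, vecPart, Finset.sum_mul]
  exact Finset.sum_congr rfl fun j _ => by ring

lemma vecPart_commutator (M N : Matrix (Idx m) (Idx m) ℝ) :
    vecPart (M * N - N * M) = psiC m M (vecPart N) - psiC m N (vecPart M) := by
  ext i
  simp [vecPart, psiC_apply, Matrix.mulVec, dotProduct, Matrix.toBlocks₁₁, matrix_mul_apply_idx]
  ring

lemma psiC_commutator_apply (M N : Matrix (Idx m) (Idx m) ℝ) (x : Rm m) :
    psiC m (M * N - N * M) x = psiC m M (psiC m N x) - psiC m N (psiC m M x)
      + covecPart N x • vecPart M - covecPart M x • vecPart N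
      - (covecPart M (vecPart N) - covecPart N (vecPart M)) • x := by
  have h : (M * N - N * M).toBlocks₁₁ = (M * N).toBlocks₁₁ - (N * M).toBlocks₁₁ := rfl
  have ha : (M * N - N * M) (Sum.inr ()) (Sum.inr ())
      = covecPart M (vecPart N) - covecPart N (vecPart M) := by
    simp [covecPart_apply, vecPart, matrix_mul_apply_idx]
    ring
  simp only [psiC_apply, ha, h, Matrix.sub_mulVec, toBlocks₁₁_mul_mulVec, Matrix.mulVec_sub,
    Matrix.mulVec_smul]
  module

lemma covecPart_mul_apply (M N : Matrix (Idx m) (Idx m) ℝ) (x : Rm m) :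
    covecPart (M * N) x = covecPart M (N.toBlocks₁₁.mulVec x)
      + M (Sum.inr ()) (Sum.inr ()) * covecPart N x := by
  simp only [covecPart_apply, matrix_mul_apply_idx, add_mul, Finset.sum_add_distrib,
    Finset.sum_mul, Finset.mul_sum, Matrix.mulVec, dotProduct, Matrix.toBlocks₁₁, Matrix.of_apply]
  congr 1
  · rw [Finset.sum_comm]
    exact Finset.sum_congr rfl fun j _ => Finset.sum_congr rfl fun l _ => by ring
  · exact Finset.sum_congr rfl fun j _ => by ring

lemma covecPart_commutator (M N : Matrix (Idx m) (Idx m) ℝ) :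
    covecPart (M * N - N * M) = covecPart M ∘L psiC m N - covecPart N ∘L psiC m M := by
  ext1 x
  have h : covecPart (M * N - N * M) x = covecPart (M * N) x - covecPart (N * M) x := by
    simp [covecPart_apply, sub_mul]
  simp [h, covecPart_mul_apply, psiC_apply]
  ring

/-- The derivative of the vector field `X^M`. -/
def projVFDeriv (M : Matrix (Idx m) (Idx m) ℝ) (x : Rm m) : GLm m :=
  -psiC m M + covecPart M x • ContinuousLinearMap.id ℝ (Rm m) + (covecPart M).smulRight x

/-- The second derivative of the vector field `X^M`. -/
def projVFDeriv₂ (M : Matrix (Idx m) (Idx m) ℝ) : Rm m →L[ℝ] GLm m :=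
  (covecPart M).smulRight (ContinuousLinearMap.id ℝ (Rm m))
    + ContinuousLinearMap.smulRightL ℝ (Rm m) (Rm m) (covecPart M)

lemma projVFDeriv₂_apply (M : Matrix (Idx m) (Idx m) ℝ) (u : Rm m) :
    projVFDeriv₂ M u = covecPart M u • ContinuousLinearMap.id ℝ (Rm m)
      + (covecPart M).smulRight u := rfl

lemma hasFDerivAt_projVF (M : Matrix (Idx m) (Idx m) ℝ) (x : Rm m) :
    HasFDerivAt (projVF m M) (projVFDeriv M x) x := by
  rw [funext (projVF_eq M)]
  have h := ((psiC m M).hasFDerivAt (x := x)).const_sub (-vecPart M)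
  refine (h.add ((covecPart M).hasFDerivAt.smul (hasFDerivAt_id x))).congr_fderiv ?_
  ext1 u
  simp [projVFDeriv]
  abel

lemma hasFDerivAt_projVFDeriv (M : Matrix (Idx m) (Idx m) ℝ) (x : Rm m) :
    HasFDerivAt (projVFDeriv M) (projVFDeriv₂ M) x := by
  have h : projVFDeriv M = fun y => -psiC m M + projVFDeriv₂ M y := by
    funext y
    simp [projVFDeriv, projVFDeriv₂, add_assoc]
  rw [h]
  exact (projVFDeriv₂ M).hasFDerivAt.const_add _

lemma projVF_commutator (M N : Matrix (Idx m) (Idx m) ℝ) (x : Rm m) :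
    projVF m (M * N - N * M) x
      = projVFDeriv N x (projVF m M x) - projVFDeriv M x (projVF m N x) := by
  simp only [projVF_eq, vecPart_commutator, psiC_commutator_apply, covecPart_commutator,
    projVFDeriv, add_apply, neg_apply, sub_apply, smul_apply, ContinuousLinearMap.comp_apply,
    ContinuousLinearMap.smulRight_apply, ContinuousLinearMap.id_apply, map_add, map_sub, map_neg,
    map_smul]
  module

lemma projVFDeriv_commutator (M N : Matrix (Idx m) (Idx m) ℝ) (x : Rm m) :
    projVFDeriv (M * N - N * M) x
      = projVFDeriv₂ N (projVF m M x) - projVFDeriv₂ M (projVF m N x)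
        + (projVFDeriv N x ∘L projVFDeriv M x - projVFDeriv M x ∘L projVFDeriv N x) := by
  ext1 u
  simp only [projVF_eq, psiC_commutator_apply, covecPart_commutator, projVFDeriv₂_apply,
    projVFDeriv, add_apply, neg_apply, sub_apply, smul_apply, ContinuousLinearMap.comp_apply,
    ContinuousLinearMap.smulRight_apply, ContinuousLinearMap.id_apply, map_add, map_sub, map_neg,
    map_smul]
  module

lemma covecPart_commutator_eq (M N : Matrix (Idx m) (Idx m) ℝ) (x : Rm m) :
    covecPart N ∘L projVFDeriv M x
      = covecPart (M * N - N * M) + covecPart M ∘L projVFDeriv N x := by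
  rw [covecPart_commutator]
  ext1 u
  simp [projVFDeriv]
  ring

end ProjectiveVectorFields

section TotalSymbols

variable {m : ℕ} {V₁ V₂ : Type}
  [NormedAddCommGroup V₁] [NormedSpace ℝ V₁] [NormedAddCommGroup V₂] [NormedSpace ℝ V₂]
  {σ₁ : GLm m →ₗ[ℝ] (V₁ →L[ℝ] V₁)} {σ₂ : GLm m →ₗ[ℝ] (V₂ →L[ℝ] V₂)} {K : ℕ}

/-- `sigmaT` as a bilinear map. -/
def sigmaTBilin (σ₁ : GLm m →ₗ[ℝ] (V₁ →L[ℝ] V₁)) (σ₂ : GLm m →ₗ[ℝ] (V₂ →L[ℝ] V₂)) (K : ℕ) :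
    GLm m →ₗ[ℝ] SymbT m V₁ V₂ K →ₗ[ℝ] SymbT m V₁ V₂ K :=
  LinearMap.mk₂ ℝ (fun B T => sigmaT m V₁ V₂ σ₁ σ₂ B T)
    (fun B C T => funext fun k => LinearMap.map_add₂ (sigmaBilin σ₁ σ₂ k) B C (T k))
    (fun c B T => funext fun k => LinearMap.map_smul₂ (sigmaBilin σ₁ σ₂ k) c B (T k))
    (fun B T U => funext fun k => map_add (sigmaBilin σ₁ σ₂ k B) (T k) (U k))
    (fun c B T => funext fun k => map_smul (sigmaBilin σ₁ σ₂ k B) c (T k))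

/-- `gTot` as a linear map. -/
def gTotLin (γf : ∀ k : ℕ, Dualm m → (Symb m V₁ V₂ (k+1) →ₗ[ℝ] Symb m V₁ V₂ k)) (K : ℕ)
    (h : Dualm m) : SymbT m V₁ V₂ K →ₗ[ℝ] SymbT m V₁ V₂ K where
  toFun := gTot m V₁ V₂ γf h
  map_add' T U := by
    funext k
    by_cases hk : (k : ℕ) + 1 < K + 1
    · simp [gTot, hk]
    · simp [gTot, hk]
  map_smul' c T := by
    funext k
    by_cases hk : (k : ℕ) + 1 < K + 1
    · simp [gTot, hk]
    · simp only [gTot, hk, dite_false, Pi.smul_apply]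
      exact (smul_zero (A := Symb m V₁ V₂ k) c).symm

lemma sigmaT_bracket (hσ₁ : IsLieRep m σ₁) (hσ₂ : IsLieRep m σ₂) (B C : GLm m)
    (T : SymbT m V₁ V₂ K) :
    sigmaT m V₁ V₂ σ₁ σ₂ (B ∘L C - C ∘L B) T
      = sigmaT m V₁ V₂ σ₁ σ₂ B (sigmaT m V₁ V₂ σ₁ σ₂ C T)
        - sigmaT m V₁ V₂ σ₁ σ₂ C (sigmaT m V₁ V₂ σ₁ σ₂ B T) :=
  funext fun k => (sigmaS_bracket hσ₁ hσ₂ B C (T k)).symm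

variable [FiniteDimensional ℝ V₁] [FiniteDimensional ℝ V₂]
  {γf : ∀ k : ℕ, Dualm m → (Symb m V₁ V₂ (k+1) →ₗ[ℝ] Symb m V₁ V₂ k)}

lemma gTot_comm (hσ₁ : IsLieRep m σ₁) (hγ : ∀ k : ℕ, gammaProp m V₁ V₂ σ₁ (γf k))
    (h h' : Dualm m) {T : SymbT m V₁ V₂ K} (hT : ∀ k : Fin (K + 1), T k ∈ spanGen m V₁ V₂ (k : ℕ)) :
    gTot m V₁ V₂ γf h (gTot m V₁ V₂ γf h' T) = gTot m V₁ V₂ γf h' (gTot m V₁ V₂ γf h T) := by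
  funext k
  by_cases hk : (k : ℕ) + 1 < K + 1
  · by_cases hk' : (k : ℕ) + 1 + 1 < K + 1
    · simp only [gTot, hk, hk', dite_true]
      exact gamma_comm hσ₁ (hγ _) (hγ _) h h' (hT ⟨(k : ℕ) + 1 + 1, hk'⟩)
    · simp only [gTot, hk, hk', dite_true, dite_false, map_zero]
  · simp only [gTot, hk, dite_false]

lemma gTot_equivariant (hσ₁ : IsLieRep m σ₁) (hγ : ∀ k : ℕ, gammaProp m V₁ V₂ σ₁ (γf k))
    (h : Dualm m) (B : GLm m) {T : SymbT m V₁ V₂ K}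
    (hT : ∀ k : Fin (K + 1), T k ∈ spanGen m V₁ V₂ (k : ℕ)) :
    gTot m V₁ V₂ γf h (sigmaT m V₁ V₂ σ₁ σ₂ B T)
      = gTot m V₁ V₂ γf (h ∘L B) T + sigmaT m V₁ V₂ σ₁ σ₂ B (gTot m V₁ V₂ γf h T) := by
  funext k
  by_cases hk : (k : ℕ) + 1 < K + 1
  · simp only [gTot, sigmaT, hk, dite_true, Pi.add_apply]
    exact gamma_equivariant hσ₁ (hγ _) h B (hT ⟨(k : ℕ) + 1, hk⟩)
  · simp only [gTot, sigmaT, hk, dite_false, Pi.add_apply]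
    rw [← sigmaBilin_apply, map_zero, add_zero]

lemma gTot_add (hγ : ∀ k : ℕ, gammaProp m V₁ V₂ σ₁ (γf k))
    (h h' : Dualm m) {T : SymbT m V₁ V₂ K} (hT : ∀ k : Fin (K + 1), T k ∈ spanGen m V₁ V₂ (k : ℕ)) :
    gTot m V₁ V₂ γf (h + h') T = gTot m V₁ V₂ γf h T + gTot m V₁ V₂ γf h' T := by
  funext k
  by_cases hk : (k : ℕ) + 1 < K + 1
  · simp only [gTot, hk, dite_true, Pi.add_apply]
    exact gamma_add (hγ _) h h' (hT ⟨(k : ℕ) + 1, hk⟩)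
  · simp only [gTot, hk, dite_false, Pi.add_apply, add_zero]

end TotalSymbols

lemma curlyL_apply {m K : ℕ} {V₁ V₂ : Type}
    [NormedAddCommGroup V₁] [NormedSpace ℝ V₁] [NormedAddCommGroup V₂] [NormedSpace ℝ V₂]
    (σ₁ : GLm m →ₗ[ℝ] (V₁ →L[ℝ] V₁)) (σ₂ : GLm m →ₗ[ℝ] (V₂ →L[ℝ] V₂))
    (γf : ∀ k : ℕ, Dualm m → (Symb m V₁ V₂ (k+1) →ₗ[ℝ] Symb m V₁ V₂ k))
    (M : Matrix (Idx m) (Idx m) ℝ) (f : Rm m → SymbT m V₁ V₂ K) (x : Rm m) :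
    curlyL m V₁ V₂ σ₁ σ₂ γf M f x = fderiv ℝ f x (projVF m M x)
      - sigmaTBilin σ₁ σ₂ K (projVFDeriv M x) (f x) + gTotLin γf K (covecPart M) (f x) := by
  rw [← (hasFDerivAt_projVF M x).fderiv]
  rfl

/-- `M ↦ 𝓛_M = L_{X^M} + γ(M)` is a representation of `sl(m+1,ℝ)` on symbols
(equivalently, `γ` is a Chevalley–Eilenberg 1-cocycle). -/
theorem statement6 (m K : ℕ) (hm : 2 ≤ m)
    (V₁ V₂ : Type) [NormedAddCommGroup V₁] [NormedSpace ℝ V₁] [FiniteDimensional ℝ V₁]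
    [NormedAddCommGroup V₂] [NormedSpace ℝ V₂] [FiniteDimensional ℝ V₂]
    (σ₁ : GLm m →ₗ[ℝ] (V₁ →L[ℝ] V₁)) (hσ₁ : IsLieRep m σ₁)
    (σ₂ : GLm m →ₗ[ℝ] (V₂ →L[ℝ] V₂)) (hσ₂ : IsLieRep m σ₂)
    (γf : ∀ k : ℕ, Dualm m → (Symb m V₁ V₂ (k+1) →ₗ[ℝ] Symb m V₁ V₂ k))
    (hγ : ∀ k : ℕ, gammaProp m V₁ V₂ σ₁ (γf k))
    (M N : Matrix (Idx m) (Idx m) ℝ) (hMtr : Matrix.trace M = 0) (hNtr : Matrix.trace N = 0)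
    (f : Rm m → SymbT m V₁ V₂ K) (hf : ContDiff ℝ (⊤ : ℕ∞) f)
    (hfval : ∀ x (k : Fin (K+1)), f x k ∈ spanGen m V₁ V₂ (k : ℕ)) :
    curlyL m V₁ V₂ σ₁ σ₂ γf M (curlyL m V₁ V₂ σ₁ σ₂ γf N f)
        - curlyL m V₁ V₂ σ₁ σ₂ γf N (curlyL m V₁ V₂ σ₁ σ₂ γf M f)
      = curlyL m V₁ V₂ σ₁ σ₂ γf (M * N - N * M) f := by
  funext x
  have hN : gTotLin γf K (covecPart N) (sigmaTBilin σ₁ σ₂ K (projVFDeriv M x) (f x))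
      = gTotLin γf K (covecPart (M * N - N * M)) (f x)
        + gTotLin γf K (covecPart M ∘L projVFDeriv N x) (f x)
        + sigmaTBilin σ₁ σ₂ K (projVFDeriv M x) (gTotLin γf K (covecPart N) (f x)) := by
    refine (gTot_equivariant hσ₁ hγ _ _ (hfval x)).trans ?_
    rw [covecPart_commutator_eq, gTot_add hγ _ _ (hfval x)]
    rfl
  have hcomm := commutator_lie_add_potential (sigmaTBilin σ₁ σ₂ K)
    (gTotLin γf K (covecPart M)) (gTotLin γf K (covecPart N))
    (contDiff_infty.1 hf 2) x
    (hasFDerivAt_projVF M x) (hasFDerivAt_projVF N x)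
    (hasFDerivAt_projVFDeriv M x) (hasFDerivAt_projVFDeriv N x)
    (sigmaT_bracket hσ₁ hσ₂ _ _ (f x)) (gTot_comm hσ₁ hγ _ _ (hfval x))
    (gTot_equivariant hσ₁ hγ _ _ (hfval x)) hN
  rw [← projVF_commutator, ← projVFDeriv_commutator] at hcomm
  rw [Pi.sub_apply]
  simp only [curlyL_apply, funext (curlyL_apply σ₁ σ₂ γf M f), funext (curlyL_apply σ₁ σ₂ γf N f)]
  exact hcomm

end ProjQuant
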